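/- Let M, N, K be positive integers, A, W ∈ ℝ^{M×N} where every entry of W is 0 or 1. Define g(U,Z) = (1/2)‖W ∘ (A − UZ)‖_F² for U ∈ ℝ^{M×K}, Z ∈ ℝ^{K×N}, and the kernel h(U,Z) = 3·((‖U‖_F² + ‖Z‖_F²)/2)² + ‖W ∘ A‖_F·(‖U‖_F² + ‖Z‖_F²)/2. Then there exists a constant L ≥ 1 such that both (U,Z) ↦ L·h(U,Z) − g(U,Z) and (U,Z) ↦ L·h(U,Z) + g(U,Z) are convex on ℝ^{M×K} × ℝ^{K×N}. -/

import Mathlib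

/-- Frobenius inner product of real matrices. -/
noncomputable def fip {m n : ℕ} (X Y : Matrix (Fin m) (Fin n) ℝ) : ℝ :=
  ∑ i, ∑ j, X i j * Y i j

/-- Frobenius norm of a real matrix. -/
noncomputable def fnorm {m n : ℕ} (X : Matrix (Fin m) (Fin n) ℝ) : ℝ :=
  Real.sqrt (fip X X)

/-- Entrywise (Hadamard) product of matrices. -/
def had {m n : ℕ} (W X : Matrix (Fin m) (Fin n) ℝ) : Matrix (Fin m) (Fin n) ℝ :=
  fun i j => W i j * X i j

theorem fip_self_nonneg {m n : ℕ} (X : Matrix (Fin m) (Fin n) ℝ) : 0 ≤ fip X X :=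
  Finset.sum_nonneg fun _ _ => Finset.sum_nonneg fun _ _ => mul_self_nonneg _

theorem fnorm_nonneg {m n : ℕ} (X : Matrix (Fin m) (Fin n) ℝ) : 0 ≤ fnorm X :=
  Real.sqrt_nonneg _

theorem fnorm_sq {m n : ℕ} (X : Matrix (Fin m) (Fin n) ℝ) : fnorm X ^ 2 = fip X X :=
  Real.sq_sqrt (fip_self_nonneg X)

theorem fip_comm {m n : ℕ} (X Y : Matrix (Fin m) (Fin n) ℝ) : fip X Y = fip Y X := by
  simp only [fip, mul_comm]

theorem fip_add_right {m n : ℕ} (X Y Z : Matrix (Fin m) (Fin n) ℝ) :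
    fip X (Y + Z) = fip X Y + fip X Z := by
  simp only [fip, Matrix.add_apply, mul_add, Finset.sum_add_distrib]

theorem fip_smul_right {m n : ℕ} (c : ℝ) (X Y : Matrix (Fin m) (Fin n) ℝ) :
    fip X (c • Y) = c * fip X Y := by
  simp only [fip, Matrix.smul_apply, smul_eq_mul, Finset.mul_sum, mul_left_comm]

theorem fip_add_left {m n : ℕ} (X Y Z : Matrix (Fin m) (Fin n) ℝ) :
    fip (X + Y) Z = fip X Z + fip Y Z := by
  simp only [fip_comm _ Z, fip_add_right]

theorem fip_sub_right {m n : ℕ} (X Y Z : Matrix (Fin m) (Fin n) ℝ) :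
    fip X (Y - Z) = fip X Y - fip X Z := by
  simp only [fip, Matrix.sub_apply, mul_sub, Finset.sum_sub_distrib]

theorem fip_sub_left {m n : ℕ} (X Y Z : Matrix (Fin m) (Fin n) ℝ) :
    fip (X - Y) Z = fip X Z - fip Y Z := by
  simp only [fip_comm _ Z, fip_sub_right]

theorem had_add {m n : ℕ} (W X Y : Matrix (Fin m) (Fin n) ℝ) :
    had W (X + Y) = had W X + had W Y := by
  ext i j; simp only [had, Matrix.add_apply, mul_add]

theorem had_sub {m n : ℕ} (W X Y : Matrix (Fin m) (Fin n) ℝ) :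
    had W (X - Y) = had W X - had W Y := by
  ext i j; simp only [had, Matrix.sub_apply, mul_sub]

theorem had_smul {m n : ℕ} (c : ℝ) (W X : Matrix (Fin m) (Fin n) ℝ) :
    had W (c • X) = c • had W X := by
  ext i j; simp only [had, Matrix.smul_apply, smul_eq_mul, mul_left_comm]

/-- Cauchy–Schwarz inequality for the Frobenius inner product. -/
theorem abs_fip_le {m n : ℕ} (X Y : Matrix (Fin m) (Fin n) ℝ) :
    |fip X Y| ≤ fnorm X * fnorm Y := by
  refine abs_le_of_sq_le_sq ?_ (mul_nonneg (fnorm_nonneg X) (fnorm_nonneg Y))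
  rw [mul_pow, fnorm_sq, fnorm_sq]
  simp only [fip, ← Fintype.sum_prod_type', ← pow_two]
  exact Finset.sum_mul_sq_le_sq_mul_sq _ _ _

/-- The Frobenius norm is submultiplicative. -/
theorem fnorm_mul_le {m k n : ℕ} (X : Matrix (Fin m) (Fin k) ℝ) (Y : Matrix (Fin k) (Fin n) ℝ) :
    fnorm (X * Y) ≤ fnorm X * fnorm Y := by
  refine (sq_le_sq₀ (fnorm_nonneg _)
    (mul_nonneg (fnorm_nonneg X) (fnorm_nonneg Y))).1 ?_
  rw [mul_pow, fnorm_sq, fnorm_sq, fnorm_sq]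
  simp only [fip, ← pow_two, Matrix.mul_apply]
  rw [Finset.sum_comm (f := fun i j => Y i j ^ 2), Finset.sum_mul_sum]
  exact Finset.sum_le_sum fun i _ => Finset.sum_le_sum fun j _ =>
    Finset.sum_mul_sq_le_sq_mul_sq _ _ _

theorem fnorm_had_le {m n : ℕ} {W : Matrix (Fin m) (Fin n) ℝ}
    (hW : ∀ i j, W i j = 0 ∨ W i j = 1) (X : Matrix (Fin m) (Fin n) ℝ) :
    fnorm (had W X) ≤ fnorm X := by
  refine Real.sqrt_le_sqrt (Finset.sum_le_sum fun i _ => Finset.sum_le_sum fun j _ => ?_)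
  rcases hW i j with h | h <;> simp [had, h, mul_self_nonneg]

theorem fnorm_add_le {m n : ℕ} (X Y : Matrix (Fin m) (Fin n) ℝ) :
    fnorm (X + Y) ≤ fnorm X + fnorm Y := by
  refine (sq_le_sq₀ (fnorm_nonneg _)
    (add_nonneg (fnorm_nonneg X) (fnorm_nonneg Y))).1 ?_
  have h := (abs_le.1 (abs_fip_le X Y)).2
  rw [fnorm_sq, fip_add_right, fip_add_left, fip_add_left, fip_comm Y X, add_sq, fnorm_sq,
    fnorm_sq]
  linarith

/-- A function with an affine minorant touching its graph at every point is convex. -/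
theorem convexOn_univ_of_exists_subgradient {E : Type*} [AddCommGroup E] [Module ℝ E] {f : E → ℝ}
    (hf : ∀ w, ∃ l : E → ℝ, IsLinearMap ℝ l ∧ ∀ d, f w + l d ≤ f (w + d)) :
    ConvexOn ℝ Set.univ f := by
  refine ⟨convex_univ, fun x _ y _ a b ha hb hab => ?_⟩
  obtain ⟨l, hl, h⟩ := hf (a • x + b • y)
  have hx := h (x - (a • x + b • y))
  have hy := h (y - (a • x + b • y))
  rw [add_sub_cancel, hl.map_sub, hl.map_add, hl.map_smul, hl.map_smul] at hx hy
  simp only [smul_eq_mul] at hx hy ⊢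
  obtain rfl : b = 1 - a := by linarith
  nlinarith [mul_le_mul_of_nonneg_left hx ha, mul_le_mul_of_nonneg_left hy hb]

/-- The second-order remainder of the matrix-completion objective is dominated by ten times that
of the quartic kernel. -/
theorem abs_remainder_le {M N K : ℕ} {W : Matrix (Fin M) (Fin N) ℝ}
    (hW : ∀ i j, W i j = 0 ∨ W i j = 1) (A : Matrix (Fin M) (Fin N) ℝ)
    (U P : Matrix (Fin M) (Fin K) ℝ) (Z Q : Matrix (Fin K) (Fin N) ℝ) :
    |1 / 2 * fnorm (had W (P * Z + U * Q + P * Q)) ^ 2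
        - fip (had W (A - U * Z)) (had W (P * Q))| ≤
      10 * (3 * ((fnorm U ^ 2 + fnorm Z ^ 2) / 2) * (fnorm P ^ 2 + fnorm Q ^ 2)
        + 3 * (fip U P + fip Z Q + (fnorm P ^ 2 + fnorm Q ^ 2) / 2) ^ 2
        + fnorm (had W A) * ((fnorm P ^ 2 + fnorm Q ^ 2) / 2)) := by
  have hC : fnorm (had W (P * Q)) ≤ fnorm P * fnorm Q :=
    (fnorm_had_le hW _).trans (fnorm_mul_le _ _)
  have hV : fnorm (had W (U * Z)) ≤ fnorm U * fnorm Z :=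
    (fnorm_had_le hW _).trans (fnorm_mul_le _ _)
  have hE : fnorm (had W (P * Z + U * Q + P * Q)) ≤
      fnorm P * fnorm Z + fnorm U * fnorm Q + fnorm P * fnorm Q := by
    refine (fnorm_had_le hW _).trans ((fnorm_add_le _ _).trans ?_)
    linarith [fnorm_add_le (P * Z) (U * Q), fnorm_mul_le P Z, fnorm_mul_le U Q, fnorm_mul_le P Q]
  have h1 := abs_fip_le (had W A) (had W (P * Q))
  have h2 := abs_fip_le (had W (U * Z)) (had W (P * Q))
  have h3 := abs_fip_le U P
  have h4 := abs_fip_le Z Q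
  rw [had_sub, fip_sub_left]
  have hu := fnorm_nonneg U
  have hz := fnorm_nonneg Z
  have hp := fnorm_nonneg P
  have hq := fnorm_nonneg Q
  have ha := fnorm_nonneg (had W A)
  have hc := fnorm_nonneg (had W (P * Q))
  have he := fnorm_nonneg (had W (P * Z + U * Q + P * Q))
  generalize fnorm (had W (P * Z + U * Q + P * Q)) = e at *
  generalize fnorm (had W (P * Q)) = c at *
  generalize fnorm (had W (U * Z)) = v at *
  generalize fnorm (had W A) = a at *
  generalize fip (had W A) (had W (P * Q)) = r1 at *
  generalize fip (had W (U * Z)) (had W (P * Q)) = r2 at *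
  generalize fip U P = s1 at *
  generalize fip Z Q = s2 at *
  generalize fnorm U = u at *
  generalize fnorm Z = z at *
  generalize fnorm P = p at *
  generalize fnorm Q = q at *
  have hpq : p * q ≤ (p ^ 2 + q ^ 2) / 2 := by nlinarith [sq_nonneg (p - q)]
  have huz : u * z ≤ (u ^ 2 + z ^ 2) / 2 := by nlinarith [sq_nonneg (u - z)]
  have hr1 : |r1| ≤ a * ((p ^ 2 + q ^ 2) / 2) :=
    h1.trans (mul_le_mul_of_nonneg_left (hC.trans hpq) ha)
  have hr2 : |r2| ≤ (u ^ 2 + z ^ 2) / 2 * ((p ^ 2 + q ^ 2) / 2) :=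
    h2.trans (mul_le_mul (hV.trans huz) (hC.trans hpq) hc (by positivity))
  have hs : (s1 + s2) ^ 2 ≤ (u ^ 2 + z ^ 2) * (p ^ 2 + q ^ 2) := by
    have : |s1 + s2| ≤ u * p + z * q := (abs_add_le _ _).trans (add_le_add h3 h4)
    calc (s1 + s2) ^ 2 = |s1 + s2| ^ 2 := (sq_abs _).symm
      _ ≤ (u * p + z * q) ^ 2 := pow_le_pow_left₀ (abs_nonneg _) this 2
      _ ≤ _ := by nlinarith [sq_nonneg (u * q - z * p)]
  have hB : (p * z + u * q) ^ 2 ≤ (u ^ 2 + z ^ 2) * (p ^ 2 + q ^ 2) := by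
    nlinarith [sq_nonneg (p * u - z * q)]
  have hpq2 : (p * q) ^ 2 ≤ ((p ^ 2 + q ^ 2) / 2) ^ 2 :=
    pow_le_pow_left₀ (by positivity) hpq 2
  have he2 : e ^ 2 ≤ 2 * ((u ^ 2 + z ^ 2) * (p ^ 2 + q ^ 2))
      + 2 * ((p ^ 2 + q ^ 2) / 2) ^ 2 := by
    have := pow_le_pow_left₀ he hE 2
    linarith [sq_nonneg (p * z + u * q - p * q)]
  have hr1' := abs_le.1 hr1
  have hr2' := abs_le.1 hr2
  have hSD : 0 ≤ (u ^ 2 + z ^ 2) * (p ^ 2 + q ^ 2) := by positivity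
  have haD : 0 ≤ a * ((p ^ 2 + q ^ 2) / 2) := by positivity
  have hT : ((p ^ 2 + q ^ 2) / 2) ^ 2 ≤ 2 * (s1 + s2 + (p ^ 2 + q ^ 2) / 2) ^ 2
      + 2 * ((u ^ 2 + z ^ 2) * (p ^ 2 + q ^ 2)) := by
    linarith [sq_nonneg (2 * (s1 + s2) + (p ^ 2 + q ^ 2) / 2)]
  have hT0 := sq_nonneg (s1 + s2 + (p ^ 2 + q ^ 2) / 2)
  rw [abs_le]
  constructor <;> linarith [sq_nonneg e]

/-- Convexity of ten times the kernel plus `ε` times the objective, for `|ε| ≤ 1`. -/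
theorem convexOn_kernel_add_objective {M N K : ℕ} {W : Matrix (Fin M) (Fin N) ℝ}
    (hW : ∀ i j, W i j = 0 ∨ W i j = 1) (A : Matrix (Fin M) (Fin N) ℝ) {ε : ℝ} (hε : |ε| ≤ 1) :
    ConvexOn ℝ Set.univ
      (fun p : Matrix (Fin M) (Fin K) ℝ × Matrix (Fin K) (Fin N) ℝ =>
        10 * (3 * ((fnorm p.1 ^ 2 + fnorm p.2 ^ 2) / 2) ^ 2 +
             fnorm (had W A) * ((fnorm p.1 ^ 2 + fnorm p.2 ^ 2) / 2)) +
        ε * ((1 / 2) * fnorm (had W (A - p.1 * p.2)) ^ 2)) := by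
  refine convexOn_univ_of_exists_subgradient fun ⟨U, Z⟩ => ?_
  refine ⟨fun d => 10 * (3 * (fnorm U ^ 2 + fnorm Z ^ 2) + fnorm (had W A)) *
      (fip U d.1 + fip Z d.2)
    - ε * fip (had W (A - U * Z)) (had W (d.1 * Z + U * d.2)), ⟨?_, ?_⟩, ?_⟩
  · rintro ⟨P, Q⟩ ⟨P', Q'⟩
    simp only [Prod.mk_add_mk, Matrix.add_mul, Matrix.mul_add, had_add, fip_add_right]
    ring
  · rintro c ⟨P, Q⟩
    simp only [Prod.smul_mk, Matrix.smul_mul, Matrix.mul_smul, had_add, had_smul, fip_add_right,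
      fip_smul_right, smul_eq_mul]
    ring
  · rintro ⟨P, Q⟩
    have key := abs_remainder_le hW A U P Z Q
    have hprod : A - (U + P) * (Z + Q) = A - U * Z - (P * Z + U * Q + P * Q) := by
      rw [Matrix.add_mul, Matrix.mul_add, Matrix.mul_add]; abel
    have hU : fnorm (U + P) ^ 2 = fnorm U ^ 2 + 2 * fip U P + fnorm P ^ 2 := by
      simp only [fnorm_sq, fip_add_left, fip_add_right, fip_comm P U]; ring
    have hZ : fnorm (Z + Q) ^ 2 = fnorm Z ^ 2 + 2 * fip Z Q + fnorm Q ^ 2 := by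
      simp only [fnorm_sq, fip_add_left, fip_add_right, fip_comm Q Z]; ring
    have hG : fnorm (had W (A - (U + P) * (Z + Q))) ^ 2 = fnorm (had W (A - U * Z)) ^ 2
        - 2 * (fip (had W (A - U * Z)) (had W (P * Z + U * Q))
          + fip (had W (A - U * Z)) (had W (P * Q)))
        + fnorm (had W (P * Z + U * Q + P * Q)) ^ 2 := by
      rw [hprod, had_sub W (A - U * Z), ← fip_add_right, ← had_add]
      generalize had W (A - U * Z) = R
      generalize had W (P * Z + U * Q + P * Q) = E
      simp only [fnorm_sq, fip_sub_left, fip_sub_right, fip_comm E R]; ring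
    simp only [Prod.mk_add_mk, hU, hZ, hG]
    have h := (abs_mul ε _).le.trans
      ((mul_le_of_le_one_left (abs_nonneg _) hε).trans key)
    linarith [(abs_le.1 h).1]

/-- for the matrix-completion objective g(U,Z) = ½‖W ∘ (A − UZ)‖_F² and
kernel h(U,Z) = 3((‖U‖²+‖Z‖²)/2)² + ‖W ∘ A‖_F(‖U‖²+‖Z‖²)/2, there is L ≥ 1 such that
both L·h − g and L·h + g are convex. -/
theorem stmt17 (M N K : ℕ) (hM : 0 < M) (hN : 0 < N) (hK : 0 < K)
    (A W : Matrix (Fin M) (Fin N) ℝ) (hW : ∀ i j, W i j = 0 ∨ W i j = 1) :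
    ∃ L : ℝ, 1 ≤ L ∧
      ConvexOn ℝ Set.univ
        (fun p : Matrix (Fin M) (Fin K) ℝ × Matrix (Fin K) (Fin N) ℝ =>
          L * (3 * ((fnorm p.1 ^ 2 + fnorm p.2 ^ 2) / 2) ^ 2 +
               fnorm (had W A) * ((fnorm p.1 ^ 2 + fnorm p.2 ^ 2) / 2)) -
          (1 / 2) * fnorm (had W (A - p.1 * p.2)) ^ 2) ∧
      ConvexOn ℝ Set.univ
        (fun p : Matrix (Fin M) (Fin K) ℝ × Matrix (Fin K) (Fin N) ℝ =>
          L * (3 * ((fnorm p.1 ^ 2 + fnorm p.2 ^ 2) / 2) ^ 2 +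
               fnorm (had W A) * ((fnorm p.1 ^ 2 + fnorm p.2 ^ 2) / 2)) +
          (1 / 2) * fnorm (had W (A - p.1 * p.2)) ^ 2) := by
  refine ⟨10, by norm_num, ?_, ?_⟩
  · simpa only [neg_one_mul, ← sub_eq_add_neg] using
      convexOn_kernel_add_objective (K := K) hW A (ε := -1) (by norm_num)
  · simpa only [one_mul] using
      convexOn_kernel_add_objective (K := K) hW A (ε := 1) (by norm_num)
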